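/- Let φ be as below and let ι be a valuation of {x₁,…,x_{2r}}. Then ι satisfies C₁ ∧ ⋯ ∧ C_m if and only if the coalition has a strategy that is winning from vC₁ against the set K_ι in the game G_φ, where K_ι = {k ≥ 1 : for all 1 ≤ i ≤ 2r, p_i divides k if and only if ι(x_i) = true}. -/

import Mathlib

/-- The prefix of length `k` of an infinite word `w`. -/
def wordPrefix {A : Type*} (w : ℕ → A) (k : ℕ) : List A := (List.range k).map w

/-- The history `ρ 0, ρ 1, …, ρ j` of a play `ρ`. -/
def histUpTo {V : Type*} (ρ : ℕ → V) (j : ℕ) : List V := (List.range (j+1)).map ρ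

/-- `h` is a history from `v₀`: nonempty, starts at `v₀`, and consecutive vertices
are linked by a nonempty transition language. -/
def IsHist {V A : Type*} (Δ : V → V → Set (List A)) (v₀ : V) (h : List V) : Prop :=
  h ≠ [] ∧ h.head? = some v₀ ∧ List.Chain' (fun u w => (Δ u w).Nonempty) h

/-- Membership of the play `ρ` in the `k`-outcome of the coalition strategy `σ` from `v₀`. -/
def InOutcome {V A : Type*} (Δ : V → V → Set (List A)) (v₀ : V) (σ : List V → ℕ → A)
    (k : ℕ) (ρ : ℕ → V) : Prop :=
  ρ 0 = v₀ ∧ ∀ j : ℕ, wordPrefix (σ (histUpTo ρ j)) k ∈ Δ (ρ j) (ρ (j+1))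

/-- The coalition strategy `σ` is winning from `v₀` for the safe set `S`. -/
def WinningFrom {V A : Type*} (Δ : V → V → Set (List A)) (S : Set V) (v₀ : V)
    (σ : List V → ℕ → A) : Prop :=
  ∀ k : ℕ, 1 ≤ k → ∀ ρ : ℕ → V, InOutcome Δ v₀ σ k ρ → ∀ j : ℕ, ρ j ∈ S

/-- Auxiliary loop-erasure on reversed histories (most recent vertex first). -/
def zipAux {V : Type*} [DecidableEq V] : List V → List V
  | [] => []
  | v' :: rest =>
    let z := zipAux rest
    if v' ∈ z then z.dropWhile (fun x => decide (x ≠ v')) else v' :: z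

/-- The loop-erasure map `zip` on histories. -/
def zip {V : Type*} [DecidableEq V] (h : List V) : List V := (zipAux h.reverse).reverse

/-- All words of the transition languages are nonempty. -/
def NonemptyWords {V A : Type*} (Δ : V → V → Set (List A)) : Prop :=
  ∀ v w : V, ∀ u ∈ Δ v w, u ≠ ([] : List A)

/-- Completeness of the arena. -/
def CompleteArena {V A : Type*} (Δ : V → V → Set (List A)) : Prop :=
  ∀ v : V, ∀ u : List A, u ≠ [] → ∃ w : V, u ∈ Δ v w

/-- Every unsafe vertex is a sink. -/
def UnsafeSinks {V A : Type*} (Δ : V → V → Set (List A)) (S : Set V) : Prop :=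
  ∀ v ∉ S, Δ v v = {u : List A | u ≠ []} ∧ ∀ w : V, w ≠ v → Δ v w = (∅ : Set (List A))

/-- A language of finite words is regular if it is accepted by a DFA with finitely
many states. -/
def IsRegularLang {A : Type*} (L : Set (List A)) : Prop :=
  ∃ (Q : Type) (_ : Fintype Q) (M : DFA A Q), ∀ u : List A, u ∈ M.accepts ↔ u ∈ L

/-- The strategy `σ` uses the memory set `M`. -/
def UsesMemory {V A : Type*} (Δ : V → V → Set (List A)) (v₀ : V)
    (σ : List V → ℕ → A) (M : Type) : Prop :=
  ∃ (minit : M) (upd : M → V → M) (next : M → V → ℕ → A),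
    ∀ h : List V, IsHist Δ v₀ h → σ h = next (h.tail.foldl upd minit) (h.getLastD v₀)

/-- The alphabet `Σ = {a, b, c, a_1, …, a_{2r}}` of the game `G_φ`
(`idx i` is the letter `a_{i+1}`). -/
inductive QA (r : ℕ) : Type where
  | a : QA r
  | b : QA r
  | c : QA r
  | idx (i : Fin (2 * r)) : QA r
deriving DecidableEq

/-- Vertices of `G_φ` (0-based indexing; `v j` is `v_j` for `0 ≤ j ≤ 2r-1`, `vx i` is
`vx_{i+1}`, `vxbar i` is `vx̄_{i+1}`, `vC h` is `vC_{h+1}`; the identifications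
`v_{2r} = vC_1` and `vC_{m+1} = ⊤` are built in). -/
inductive QV (r m : ℕ) : Type where
  | v (j : Fin (2 * r)) : QV r m
  | vx (i : Fin (2 * r)) : QV r m
  | vxbar (i : Fin (2 * r)) : QV r m
  | vC (h : Fin m) : QV r m
  | top : QV r m
  | bot : QV r m
deriving DecidableEq

/-- The `(i+1)`-st prime number (`Nat.nth Nat.Prime 0 = 2`). -/
noncomputable def prm (i : ℕ) : ℕ := Nat.nth Nat.Prime i

/-- `Σ⁺` over `QA r`. -/
def qSigPlus (r : ℕ) : Set (List (QA r)) := {u | u ≠ []}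

/-- The language of the literal `p = (i, pol)`: `{a_{i+1}^n : n ∈ M_{i+1}}` if `pol` is
true (literal `x_{i+1}`), and `{a_{i+1}^n : n ≥ 1, n ∉ M_{i+1}}` if `pol` is false
(literal `¬x_{i+1}`). -/
def litLang (r : ℕ) (p : Fin (2 * r) × Bool) : Set (List (QA r)) :=
  {u | ∃ n : ℕ, 1 ≤ n ∧ (prm p.1.val ∣ n ↔ p.2 = true) ∧
        u = List.replicate n (QA.idx p.1)}

/-- The explicitly specified transitions of `G_φ`, for `φ` with `2r` variables and `m`
clauses whose literals are given by `lit` (`lit h j = (i, pol)` meaning the `(j+1)`-st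
literal of clause `C_{h+1}` is `x_{i+1}` if `pol` and `¬x_{i+1}` otherwise). -/
noncomputable def qbfMain (r m : ℕ) (lit : Fin m → Fin 3 → Fin (2 * r) × Bool) :
    QV r m → QV r m → Set (List (QA r))
  | QV.v j, QV.vx i =>
      if i = j then
        (if j.val % 2 = 0 then
          {u | ∃ n : ℕ, 1 ≤ n ∧ prm j.val ∣ n ∧ u = List.replicate n QA.a}
        else
          {u | ∃ n : ℕ, 1 ≤ n ∧ prm j.val ∣ n ∧ u = List.replicate n QA.c})
      else ∅
  | QV.v j, QV.vxbar i =>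
      if i = j then
        (if j.val % 2 = 0 then
          {u | ∃ n : ℕ, 1 ≤ n ∧ ¬ prm j.val ∣ n ∧ u = List.replicate n QA.b}
        else
          {u | ∃ n : ℕ, 1 ≤ n ∧ ¬ prm j.val ∣ n ∧ u = List.replicate n QA.c})
      else ∅
  | QV.v j, QV.top =>
      if j.val % 2 = 0 then
        {u | ∃ n : ℕ, 1 ≤ n ∧ ¬ prm j.val ∣ n ∧ u = List.replicate n QA.a} ∪
        {u | ∃ n : ℕ, 1 ≤ n ∧ prm j.val ∣ n ∧ u = List.replicate n QA.b}
      else ∅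
  | QV.vx i, QV.v j => if j.val = i.val + 1 then qSigPlus r else ∅
  | QV.vxbar i, QV.v j => if j.val = i.val + 1 then qSigPlus r else ∅
  | QV.vx i, QV.vC h => if i.val = 2 * r - 1 ∧ h.val = 0 then qSigPlus r else ∅
  | QV.vxbar i, QV.vC h => if i.val = 2 * r - 1 ∧ h.val = 0 then qSigPlus r else ∅
  | QV.vC h, QV.vC h' =>
      if h'.val = h.val + 1 then ⋃ jj : Fin 3, litLang r (lit h jj) else ∅
  | QV.vC h, QV.top =>
      if h.val = m - 1 then ⋃ jj : Fin 3, litLang r (lit h jj) else ∅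
  | QV.top, QV.top => qSigPlus r
  | QV.bot, QV.bot => qSigPlus r
  | _, _ => ∅

/-- The transition function of `G_φ`: every nonempty word not covered by the specified
transitions leads from any vertex `v ≠ ⊥` to `⊥`. -/
noncomputable def qbfDelta (r m : ℕ) (lit : Fin m → Fin 3 → Fin (2 * r) × Bool) :
    QV r m → QV r m → Set (List (QA r)) := fun v w =>
  if v ≠ QV.bot ∧ w = QV.bot then
    {u | u ≠ [] ∧ ∀ w' : QV r m, u ∉ qbfMain r m lit v w'}
  else qbfMain r m lit v w

/-- The safe set of `G_φ`: everything but `⊥`. -/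
def qbfSafe (r m : ℕ) : Set (QV r m) := {v | v ≠ QV.bot}

/-- The valuation `ι` satisfies the matrix `C₁ ∧ ⋯ ∧ C_m`. -/
def SatisfiesMatrix (r m : ℕ) (lit : Fin m → Fin 3 → Fin (2 * r) × Bool)
    (ι : Fin (2 * r) → Bool) : Prop :=
  ∀ h : Fin m, ∃ j : Fin 3, ι (lit h j).1 = (lit h j).2

/-- `σ` is winning from `v₀` against the set `K` of possible numbers of agents: for
every `k ∈ K`, every play of the `k`-outcome stays in `S`. -/
def WinningAgainst {V A : Type*} (Δ : V → V → Set (List A)) (S : Set V) (v₀ : V)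
    (K : Set ℕ) (σ : List V → ℕ → A) : Prop :=
  ∀ k ∈ K, ∀ ρ : ℕ → V, InOutcome Δ v₀ σ k ρ → ∀ j : ℕ, ρ j ∈ S

theorem CompleteArena.exists_inOutcome {V A : Type*} {Δ : V → V → Set (List A)}
    (hΔ : CompleteArena Δ) (v₀ : V) (σ : List V → ℕ → A) {k : ℕ} (hk : 1 ≤ k) :
    ∃ ρ : ℕ → V, InOutcome Δ v₀ σ k ρ := by
  have hne (w : ℕ → A) : wordPrefix w k ≠ [] := by
    simp [wordPrefix, List.map_eq_nil_iff]
    omega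
  choose nxt hnxt using fun (v : V) (w : ℕ → A) => hΔ v (wordPrefix w k) (hne w)
  let H : ℕ → List V := fun n =>
    Nat.rec [v₀] (fun _ l => l ++ [nxt (l.getLastD v₀) (σ l)]) n
  let ρ : ℕ → V := fun n => (H n).getLastD v₀
  have hsucc (n : ℕ) : H (n + 1) = H n ++ [nxt (ρ n) (σ (H n))] := rfl
  have hρ (n : ℕ) : ρ (n + 1) = nxt (ρ n) (σ (H n)) := by
    change (H (n + 1)).getLastD v₀ = _
    rw [hsucc]
    simp
  have hH (n : ℕ) : histUpTo ρ n = H n := by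
    induction n with
    | zero => rfl
    | succ n ih =>
      rw [hsucc, ← hρ, ← ih]
      simp [histUpTo, List.range_succ]
  refine ⟨ρ, rfl, fun j => ?_⟩
  rw [hH, hρ]
  exact hnxt _ _

theorem histUpTo_getLastD {V : Type*} (ρ : ℕ → V) (j : ℕ) (d : V) :
    (histUpTo ρ j).getLastD d = ρ j := by
  simp [histUpTo, List.range_succ]

theorem wordPrefix_const {A : Type*} (x : A) (k : ℕ) :
    wordPrefix (fun _ => x) k = List.replicate k x := by
  simp [wordPrefix]

theorem prime_prm (i : ℕ) : (prm i).Prime :=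
  Nat.prime_nth_prime i

theorem prm_injective : Function.Injective prm :=
  Nat.nth_injective Nat.infinite_setOfPred_prime

theorem completeArena_qbfDelta (r m : ℕ) (lit : Fin m → Fin 3 → Fin (2 * r) × Bool) :
    CompleteArena (qbfDelta r m lit) := by
  intro v u hu
  by_cases hv : v = QV.bot
  · exact ⟨QV.bot, by simpa [qbfDelta, qbfMain, qSigPlus, hv] using hu⟩
  by_cases h : ∃ w, w ≠ QV.bot ∧ u ∈ qbfMain r m lit v w
  · obtain ⟨w, hw, huw⟩ := h
    exact ⟨w, by simpa [qbfDelta, hw] using huw⟩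
  · refine ⟨QV.bot, ?_⟩
    have hbot : u ∉ qbfMain r m lit v QV.bot := by
      cases v <;> simp_all [qbfMain]
    simp only [qbfDelta, hv, ne_eq, not_false_eq_true, and_self, if_true, Set.mem_ofPred_eq]
    refine ⟨hu, fun w hw => ?_⟩
    by_cases hwb : w = QV.bot
    · exact hbot (hwb ▸ hw)
    · exact h ⟨w, hwb, hw⟩

/-- The edges leaving a clause vertex: the successor other than `⊥` is unique and is reached
exactly by the words of the literals of the clause. -/
theorem mem_qbfDelta_vC {r m : ℕ} {lit : Fin m → Fin 3 → Fin (2 * r) × Bool} {h : Fin m}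
    {w : QV r m} {u : List (QA r)} (hw : w ≠ QV.bot) :
    u ∈ qbfDelta r m lit (QV.vC h) w ↔
      (∃ j, u ∈ litLang r (lit h j)) ∧
        w = if hlt : h.val + 1 < m then QV.vC ⟨h.val + 1, hlt⟩ else QV.top := by
  have hh := h.isLt
  cases w with
  | vC h' =>
    have hh' := h'.isLt
    by_cases he : h'.val = h.val + 1
    · have hlt : h.val + 1 < m := he ▸ hh'
      simp [qbfDelta, qbfMain, he, hlt, Fin.ext_iff]
    · simp only [qbfDelta, qbfMain]
      split_ifs <;> simp_all [Fin.ext_iff]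
  | top =>
    by_cases he : h.val = m - 1
    · have hlt : ¬ h.val + 1 < m := by omega
      simp [qbfDelta, qbfMain, he, show ¬ m - 1 + 1 < m by omega]
    · have hlt : h.val + 1 < m := by omega
      simp [qbfDelta, qbfMain, he, hlt]
  | bot => exact absurd rfl hw
  | _ =>
    simp only [qbfDelta, qbfMain]
    split_ifs <;> simp_all

/-- A word of some literal of the clause does not lead to `⊥`. -/
theorem ne_bot_of_mem_qbfDelta_vC {r m : ℕ} {lit : Fin m → Fin 3 → Fin (2 * r) × Bool}
    {h : Fin m} {w : QV r m} {u : List (QA r)} (hu : ∃ j, u ∈ litLang r (lit h j))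
    (huw : u ∈ qbfDelta r m lit (QV.vC h) w) : w ≠ QV.bot := by
  rintro rfl
  have hs : (if hlt : h.val + 1 < m then QV.vC ⟨h.val + 1, hlt⟩ else QV.top : QV r m) ≠
      QV.bot := by
    split_ifs <;> simp
  have hmem := (mem_qbfDelta_vC (lit := lit) hs).2 ⟨hu, rfl⟩
  simp only [qbfDelta, hs, and_false, if_false] at hmem
  simp only [qbfDelta, ne_eq, reduceCtorEq, not_false_eq_true, and_self, if_true,
    Set.mem_ofPred_eq] at huw
  exact huw.2 _ hmem

theorem eq_top_of_mem_qbfDelta_top {r m : ℕ} {lit : Fin m → Fin 3 → Fin (2 * r) × Bool}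
    {w : QV r m} {u : List (QA r)} (huw : u ∈ qbfDelta r m lit QV.top w) : w = QV.top := by
  cases w with
  | bot =>
    simp only [qbfDelta, ne_eq, reduceCtorEq, not_false_eq_true, and_self, if_true,
      Set.mem_ofPred_eq] at huw
    exact absurd huw.1 (huw.2 QV.top)
  | top => rfl
  | _ => simp [qbfDelta, qbfMain] at huw

/-- Some number of agents is divisible by exactly the primes selected by the valuation. -/
theorem exists_prm_dvd_iff {n : ℕ} (ι : Fin n → Bool) :
    ∃ k : ℕ, 1 ≤ k ∧ ∀ i : Fin n, (prm i.val ∣ k ↔ ι i = true) := by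
  refine ⟨∏ i with ι i = true, prm i.val,
    Nat.one_le_iff_ne_zero.2 <| Finset.prod_ne_zero_iff.2 fun i _ => (prime_prm i.val).ne_zero,
    fun i => ?_⟩
  rw [(prime_prm i).prime.dvd_finsetProd_iff]
  constructor
  · rintro ⟨j, hj, hij⟩
    rw [Nat.prime_dvd_prime_iff_eq (prime_prm _) (prime_prm _)] at hij
    have : i = j := Fin.ext (prm_injective hij)
    simpa [this] using hj
  · exact fun hi => ⟨i, by simpa using hi, dvd_rfl⟩

theorem exists_winningAgainst_of_satisfiesMatrix {r m : ℕ}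
    {lit : Fin m → Fin 3 → Fin (2 * r) × Bool} {ι : Fin (2 * r) → Bool}
    (hsat : SatisfiesMatrix r m lit ι) (h₀ : Fin m) :
    ∃ σ : List (QV r m) → ℕ → QA r,
      WinningAgainst (qbfDelta r m lit) (qbfSafe r m) (QV.vC h₀)
        {k : ℕ | 1 ≤ k ∧ ∀ i : Fin (2 * r), (prm i.val ∣ k ↔ ι i = true)} σ := by
  choose J hJ using hsat
  let letter : QV r m → QA r
    | QV.vC h => QA.idx (lit h (J h)).1
    | _ => QA.a
  refine ⟨fun l _ => letter (l.getLastD QV.bot), ?_⟩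
  rintro k ⟨hk, hdvd⟩ ρ ⟨hρ₀, hρ⟩
  simp only [histUpTo_getLastD, wordPrefix_const] at hρ
  have key : ∀ j, (∃ h, ρ j = QV.vC h) ∨ ρ j = QV.top := by
    intro j
    induction j with
    | zero => exact Or.inl ⟨_, hρ₀⟩
    | succ j ih =>
      have hstep := hρ j
      rcases ih with ⟨h, hj⟩ | hj
      · rw [hj] at hstep
        have hu : ∃ i, List.replicate k (letter (QV.vC h)) ∈ litLang r (lit h i) :=
          ⟨J h, k, hk, by rw [hdvd, hJ], rfl⟩
        have hnext := ((mem_qbfDelta_vC (ne_bot_of_mem_qbfDelta_vC hu hstep)).1 hstep).2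
        split_ifs at hnext with hlt
        · exact Or.inl ⟨_, hnext⟩
        · exact Or.inr hnext
      · rw [hj] at hstep
        exact Or.inr (eq_top_of_mem_qbfDelta_top hstep)
  intro j
  rcases key j with ⟨h, hj⟩ | hj <;> simp [qbfSafe, hj]

theorem satisfiesMatrix_of_winningAgainst {r m : ℕ} (hm : 0 < m)
    {lit : Fin m → Fin 3 → Fin (2 * r) × Bool} {ι : Fin (2 * r) → Bool}
    {σ : List (QV r m) → ℕ → QA r}
    (hσ : WinningAgainst (qbfDelta r m lit) (qbfSafe r m) (QV.vC ⟨0, hm⟩)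
      {k : ℕ | 1 ≤ k ∧ ∀ i : Fin (2 * r), (prm i.val ∣ k ↔ ι i = true)} σ) :
    SatisfiesMatrix r m lit ι := by
  obtain ⟨k, hk, hdvd⟩ := exists_prm_dvd_iff ι
  obtain ⟨ρ, hρ⟩ := (completeArena_qbfDelta r m lit).exists_inOutcome (QV.vC ⟨0, hm⟩) σ hk
  have hsafe : ∀ j, ρ j ≠ QV.bot := hσ k ⟨hk, hdvd⟩ ρ hρ
  have hvC : ∀ t (ht : t < m), ρ t = QV.vC ⟨t, ht⟩ := by
    intro t
    induction t with
    | zero => exact fun _ => hρ.1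
    | succ t ih =>
      intro ht
      have hstep := hρ.2 t
      rw [ih (by omega), mem_qbfDelta_vC (hsafe _)] at hstep
      simpa [ht] using hstep.2
  intro h
  have hstep := hρ.2 h.val
  rw [hvC h.val h.isLt, mem_qbfDelta_vC (hsafe _)] at hstep
  obtain ⟨⟨j, n, -, hn, hword⟩, -⟩ := hstep
  have hkn : k = n := by simpa [wordPrefix] using congrArg List.length hword
  rw [← hkn, hdvd] at hn
  exact ⟨j, Bool.eq_iff_iff.2 hn⟩

/-- a valuation `ι` satisfies `C₁ ∧ ⋯ ∧ C_m` iff the coalition has a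
strategy winning from `vC₁` against
`K_ι = {k ≥ 1 : ∀ i, p_i ∣ k ↔ ι(x_i) = true}` in `G_φ`. -/
theorem stmt14 (r m : ℕ) (hr : 1 ≤ r) (hm : 1 ≤ m)
    (lit : Fin m → Fin 3 → Fin (2 * r) × Bool) (ι : Fin (2 * r) → Bool) :
    SatisfiesMatrix r m lit ι ↔
      ∃ σ : List (QV r m) → ℕ → QA r,
        WinningAgainst (qbfDelta r m lit) (qbfSafe r m) (QV.vC ⟨0, by omega⟩)
          {k : ℕ | 1 ≤ k ∧ ∀ i : Fin (2 * r), (prm i.val ∣ k ↔ ι i = true)} σ := by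
  exact ⟨fun hsat => exists_winningAgainst_of_satisfiesMatrix hsat _,
    fun ⟨_, hσ⟩ => satisfiesMatrix_of_winningAgainst hm hσ⟩
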